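/- arXiv:1008.1658 — 4 statements merged into one kernel-verified Lean document; each statement's English description precedes it below -/
import Mathlib

section
/- Let A be a DTA(NFA) or an SDTA over a finite alphabet Σ with vertical state set Q, recognizing the tree language L = L(A). Suppose R = {t_1, …, t_m} ⊆ T_Σ is a set of m pairwise distinct trees such that for all 1 ≤ i < j ≤ m there exists a context t ∈ T_Σ[x] with: t(x←t_i) ∈ L if and only if t(x←t_j) ∉ L. Then |Q| ≥ m − 1. -/
/-- Unranked trees over alphabet `α`: a node label together with a finite ordered
list of subtrees. -/
inductive UTree (α : Type) : Type where
  | node : α → List (UTree α) → UTree α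

/-- Bottom-up reachability: `TReach δ t q` holds iff state `q` can be reached at the
root of tree `t` using the horizontal languages `δ`. -/
inductive TReach {α Q : Type} (δ : Q → α → Set (List Q)) : UTree α → Q → Prop where
  | node {a : α} {ts : List (UTree α)} {qs : List Q} {q : Q}
      (hlen : ts.length = qs.length)
      (hchild : ∀ i : Fin ts.length, TReach δ (ts.get i) (qs.get (Fin.cast hlen i)))
      (hq : qs ∈ δ q a) : TReach δ (UTree.node a ts) q

/-- The tree language defined by transitions `δ` and final states `F`. -/
def TLang {α Q : Type} (δ : Q → α → Set (List Q)) (F : Set Q) : Set (UTree α) :=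
  {t | ∃ q ∈ F, TReach δ t q}

/-- Contexts: unranked trees with exactly one leaf occurrence of a hole (the variable `x`). -/
inductive UCtx (α : Type) : Type where
  | hole : UCtx α
  | node : α → List (UTree α) → UCtx α → List (UTree α) → UCtx α

/-- Substituting a tree for the hole of a context. -/
def UCtx.subst {α : Type} : UCtx α → UTree α → UTree α
  | .hole, t => t
  | .node a l c r, t => UTree.node a (l ++ c.subst t :: r)

/-- Determinism of a tree automaton: the horizontal languages of distinct
vertical states are disjoint. -/
def IsDet {α Q R : Type} (δ : Q → α → Set (List R)) : Prop :=
  ∀ (a : α) (q₁ q₂ : Q), q₁ ≠ q₂ → δ q₁ a ∩ δ q₂ a = ∅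

/-! ### Plain (no leaf convention) models -/

/-- A strongly deterministic unranked tree automaton (SDTA): for each symbol `a` a
single complete DFA over the alphabet of vertical states, with final states `hacc a`
and output function `out a`. -/
structure SDTA (α : Type) where
  Q : Type
  [finQ : Fintype Q]
  S : α → Type
  [finS : ∀ a, Fintype (S a)]
  start : ∀ a : α, S a
  step : ∀ a : α, S a → Q → S a
  hacc : ∀ a : α, Set (S a)
  out : ∀ a : α, S a → Q
  F : Set Q

attribute [instance] SDTA.finQ SDTA.finS

namespace SDTA
variable {α : Type} (A : SDTA α)

/-- Horizontal language `δ(q,a)` of an SDTA. -/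
def hLang (q : A.Q) (a : α) : Set (List A.Q) :=
  {w | w.foldl (A.step a) (A.start a) ∈ A.hacc a ∧
       A.out a (w.foldl (A.step a) (A.start a)) = q}

/-- The tree language recognized by an SDTA. -/
def lang : Set (UTree α) := TLang A.hLang A.F

/-- Number of vertical states. -/
def vcard : ℕ := Fintype.card A.Q

/-- Number of horizontal states: `Σ_{σ∈Σ} |S_σ|`. -/
def hcard [Fintype α] : ℕ := ∑ a : α, Fintype.card (A.S a)

end SDTA

/-- An NTA(NFA): an unranked tree automaton whose horizontal language for each
vertical state `q` and symbol `a` is given by an NFA over the alphabet of vertical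
states. -/
structure NTAN (α : Type) where
  Q : Type
  [finQ : Fintype Q]
  S : Q → α → Type
  [finS : ∀ q a, Fintype (S q a)]
  H : ∀ (q : Q) (a : α), NFA Q (S q a)
  F : Set Q

attribute [instance] NTAN.finQ NTAN.finS

namespace NTAN
variable {α : Type} (A : NTAN α)

/-- Horizontal language `δ(q,a)`. -/
def hLang (q : A.Q) (a : α) : Set (List A.Q) := (A.H q a).accepts

/-- The tree language recognized. -/
def lang : Set (UTree α) := TLang A.hLang A.F

/-- Number of vertical states. -/
def vcard : ℕ := Fintype.card A.Q

/-- Number of horizontal states: `Σ_{q∈Q,σ∈Σ} |S_{q,σ}|`. -/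
def hcard [Fintype α] : ℕ := ∑ q : A.Q, ∑ a : α, Fintype.card (A.S q a)

/-- A DTA(NFA) is an NTA(NFA) that is deterministic. -/
def IsDTA : Prop := IsDet A.hLang

end NTAN

/-- An NTA(DFA): an unranked tree automaton whose horizontal language for each
vertical state `q` and symbol `a` is given by a complete DFA over the alphabet of
vertical states. -/
structure NTAD (α : Type) where
  Q : Type
  [finQ : Fintype Q]
  S : Q → α → Type
  [finS : ∀ q a, Fintype (S q a)]
  H : ∀ (q : Q) (a : α), DFA Q (S q a)
  F : Set Q

attribute [instance] NTAD.finQ NTAD.finS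

namespace NTAD
variable {α : Type} (A : NTAD α)

/-- Horizontal language `δ(q,a)`. -/
def hLang (q : A.Q) (a : α) : Set (List A.Q) := (A.H q a).accepts

/-- The tree language recognized. -/
def lang : Set (UTree α) := TLang A.hLang A.F

/-- Number of vertical states. -/
def vcard : ℕ := Fintype.card A.Q

/-- Number of horizontal states: `Σ_{q∈Q,σ∈Σ} |S_{q,σ}|`. -/
def hcard [Fintype α] : ℕ := ∑ q : A.Q, ∑ a : α, Fintype.card (A.S q a)

/-- A DTA(DFA) is an NTA(DFA) that is deterministic. -/
def IsDTA : Prop := IsDet A.hLang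

end NTAD

/-! ### Models with the leaf convention

Under the leaf convention, every leaf labelled `σ` is assigned a special
state `σ̄` used nowhere else: `δ(σ̄,σ) = {ε}`, `ε ∉ δ(q,σ)` for counted vertical
states `q`, and `δ(τ̄,σ) = ∅` for `τ ≠ σ`.  The full vertical state set is
`Q ⊕ α`, where only the states in `Q` (and only the horizontal automata attached
to them) are counted. -/

/-- Extension of horizontal languages (given on the counted states `Q`) to the full
state set `Q ⊕ α` by the leaf convention. -/
def leafδ {α Q : Type} (δ : Q → α → Set (List (Q ⊕ α))) :
    Q ⊕ α → α → Set (List (Q ⊕ α))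
  | Sum.inl q, a => δ q a
  | Sum.inr τ, a => {w | τ = a ∧ w = []}

/-- An SDTA observing the leaf convention. -/
structure CSDTA (α : Type) where
  Q : Type
  [finQ : Fintype Q]
  S : α → Type
  [finS : ∀ a, Fintype (S a)]
  start : ∀ a : α, S a
  step : ∀ a : α, S a → Q ⊕ α → S a
  hacc : ∀ a : α, Set (S a)
  out : ∀ a : α, S a → Q
  F : Set (Q ⊕ α)
  noeps : ∀ a : α, start a ∉ hacc a

attribute [instance] CSDTA.finQ CSDTA.finS

namespace CSDTA
variable {α : Type} (A : CSDTA α)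

/-- Horizontal language `δ(q,a)` for a counted vertical state `q`. -/
def hLang (q : A.Q) (a : α) : Set (List (A.Q ⊕ α)) :=
  {w | w.foldl (A.step a) (A.start a) ∈ A.hacc a ∧
       A.out a (w.foldl (A.step a) (A.start a)) = q}

/-- The tree language recognized. -/
def lang : Set (UTree α) := TLang (leafδ A.hLang) A.F

/-- Number of (counted) vertical states. -/
def vcard : ℕ := Fintype.card A.Q

/-- Number of horizontal states: `Σ_{σ∈Σ} |S_σ|`. -/
def hcard [Fintype α] : ℕ := ∑ a : α, Fintype.card (A.S a)

end CSDTA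

/-- An NTA(DFA) observing the leaf convention. -/
structure CNTAD (α : Type) where
  Q : Type
  [finQ : Fintype Q]
  S : Q → α → Type
  [finS : ∀ q a, Fintype (S q a)]
  H : ∀ (q : Q) (a : α), DFA (Q ⊕ α) (S q a)
  F : Set (Q ⊕ α)
  noeps : ∀ (q : Q) (a : α), [] ∉ (H q a).accepts

attribute [instance] CNTAD.finQ CNTAD.finS

namespace CNTAD
variable {α : Type} (A : CNTAD α)

/-- Horizontal language `δ(q,a)` for a counted vertical state `q`. -/
def hLang (q : A.Q) (a : α) : Set (List (A.Q ⊕ α)) := (A.H q a).accepts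

/-- The tree language recognized. -/
def lang : Set (UTree α) := TLang (leafδ A.hLang) A.F

/-- Number of (counted) vertical states. -/
def vcard : ℕ := Fintype.card A.Q

/-- Number of horizontal states: `Σ_{q∈Q,σ∈Σ} |S_{q,σ}|`. -/
def hcard [Fintype α] : ℕ := ∑ q : A.Q, ∑ a : α, Fintype.card (A.S q a)

/-- A DTA(DFA) with the leaf convention is a CNTAD that is deterministic. -/
def IsDTA : Prop := IsDet A.hLang

end CNTAD

/-- An NTA(NFA) observing the leaf convention. -/
structure CNTAN (α : Type) where
  Q : Type
  [finQ : Fintype Q]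
  S : Q → α → Type
  [finS : ∀ q a, Fintype (S q a)]
  H : ∀ (q : Q) (a : α), NFA (Q ⊕ α) (S q a)
  F : Set (Q ⊕ α)
  noeps : ∀ (q : Q) (a : α), [] ∉ (H q a).accepts

attribute [instance] CNTAN.finQ CNTAN.finS

namespace CNTAN
variable {α : Type} (A : CNTAN α)

/-- Horizontal language `δ(q,a)` for a counted vertical state `q`. -/
def hLang (q : A.Q) (a : α) : Set (List (A.Q ⊕ α)) := (A.H q a).accepts

/-- The tree language recognized. -/
def lang : Set (UTree α) := TLang (leafδ A.hLang) A.F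

/-- Number of (counted) vertical states. -/
def vcard : ℕ := Fintype.card A.Q

/-- Number of horizontal states: `Σ_{q∈Q,σ∈Σ} |S_{q,σ}|`. -/
def hcard [Fintype α] : ℕ := ∑ q : A.Q, ∑ a : α, Fintype.card (A.S q a)

/-- A DTA(NFA) with the leaf convention is a CNTAN that is deterministic. -/
def IsDTA : Prop := IsDet A.hLang

end CNTAN


/-- Replacing one entry of the left list preserves `List.Forall₂` when the new entry is related
to everything the old one is related to. -/
theorem List.Forall₂.replace_left {β γ : Type*} {R : β → γ → Prop} {s s' : β} {r : List β}
    (h : ∀ q, R s q → R s' q) :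
    ∀ {l : List β} {qs : List γ}, List.Forall₂ R (l ++ s :: r) qs →
      List.Forall₂ R (l ++ s' :: r) qs
  | [], _, .cons hs hr => .cons (h _ hs) hr
  | _ :: _, _, .cons ha hl => .cons ha (List.Forall₂.replace_left h hl)

theorem treach_node_iff {α Q : Type} {δ : Q → α → Set (List Q)} {a : α} {ts : List (UTree α)}
    {q : Q} : TReach δ (UTree.node a ts) q ↔ ∃ qs ∈ δ q a, List.Forall₂ (TReach δ) ts qs := by
  constructor
  · rintro ⟨hlen, hchild, hq⟩
    exact ⟨_, hq, List.forall₂_iff_get.2 ⟨hlen, fun i h _ => hchild ⟨i, h⟩⟩⟩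
  · rintro ⟨qs, hq, h⟩
    obtain ⟨hlen, hget⟩ := List.forall₂_iff_get.1 h
    exact ⟨hlen, fun i => hget i i.2 (hlen ▸ i.2), hq⟩

/-- Enlarging the set of states reachable at the hole enlarges the set of states reachable at
the root of a context. -/
theorem TReach.subst_mono {α Q : Type} {δ : Q → α → Set (List Q)} {t t' : UTree α}
    (h : ∀ q, TReach δ t q → TReach δ t' q) (c : UCtx α) (q : Q) :
    TReach δ (c.subst t) q → TReach δ (c.subst t') q := by
  induction c generalizing q with
  | hole => exact h q
  | node a l c r ih =>
    simp only [UCtx.subst, treach_node_iff]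
    rintro ⟨qs, hq, hqs⟩
    exact ⟨qs, hq, hqs.replace_left ih⟩

/-- In a deterministic automaton at most one state is reachable at the root of a tree. -/
theorem TReach.unique {α Q : Type} {δ : Q → α → Set (List Q)} (hδ : IsDet δ) {t : UTree α}
    {q q' : Q} (h : TReach δ t q) (h' : TReach δ t q') : q = q' := by
  induction h generalizing q' with
  | @node a ts qs q hlen _ hq ih =>
    obtain ⟨hlen', hchild', hq'⟩ := h'
    rename_i qs'
    have hqs : qs = qs' := by
      refine List.ext_get (hlen.symm.trans hlen') fun i h₁ _ => ?_
      exact ih ⟨i, hlen.symm ▸ h₁⟩ (hchild' ⟨i, hlen.symm ▸ h₁⟩)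
    subst hqs
    by_contra hne
    exact (Set.mem_empty_iff_false qs).1 (hδ a q q' hne ▸ ⟨hq, hq'⟩)

/-- If any two of `m` trees are separated by a context with respect to the language of a
deterministic automaton, then the automaton has at least `m - 1` states. -/
theorem IsDet.sub_one_le_card {α Q : Type} [Fintype Q] {δ : Q → α → Set (List Q)}
    (hδ : IsDet δ) (F : Set Q) {m : ℕ} (t : Fin m → UTree α)
    (hsep : ∀ i j : Fin m, i < j → ∃ c : UCtx α,
      (c.subst (t i) ∈ TLang δ F ↔ c.subst (t j) ∉ TLang δ F)) :
    m - 1 ≤ Fintype.card Q := by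
  classical
  have hstate : ∀ i, ∃ o : Option Q, ∀ q, TReach δ (t i) q ↔ o = some q := fun i => by
    by_cases h : ∃ q, TReach δ (t i) q
    · obtain ⟨q, hq⟩ := h
      refine ⟨some q, fun q' => ⟨fun h' => congrArg some (hq.unique hδ h'), fun h' => ?_⟩⟩
      exact Option.some.inj h' ▸ hq
    · exact ⟨none, fun q => ⟨fun hq => (h ⟨q, hq⟩).elim, fun hq => nomatch hq⟩⟩
  choose f hf using hstate
  have hne : ∀ i j, i < j → f i ≠ f j := fun i j hij hfij => by
    obtain ⟨c, hc⟩ := hsep i j hij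
    have hsame : c.subst (t i) ∈ TLang δ F ↔ c.subst (t j) ∈ TLang δ F :=
      exists_congr fun q => and_congr_right fun _ =>
        ⟨TReach.subst_mono (fun q h => (hf j q).2 (hfij ▸ (hf i q).1 h)) c q,
          TReach.subst_mono (fun q h => (hf i q).2 (hfij ▸ (hf j q).1 h)) c q⟩
    tauto
  have hinj : Function.Injective f := fun i j hij => by
    rcases lt_trichotomy i j with h | h | h
    · exact (hne i j h hij).elim
    · exact h
    · exact (hne j i h hij.symm).elim
  have hcard := Fintype.card_le_of_injective f hinj
  rw [Fintype.card_fin, Fintype.card_option] at hcard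
  omega

theorem SDTA.isDet_hLang {α : Type} (A : SDTA α) : IsDet A.hLang := fun _ _ _ hne =>
  Set.eq_empty_of_forall_notMem fun _ h => hne (h.1.2.symm.trans h.2.2)

/-- if `A` is a DTA(NFA) or an SDTA recognizing `L` and
`t_1, …, t_m` are pairwise distinct trees such that any two of them are
separated by some context, then `A` has at least `m - 1` vertical states. -/
theorem statement0 :
    (∀ (α : Type) (A : NTAN α), A.IsDTA →
      ∀ (m : ℕ) (t : Fin m → UTree α), Function.Injective t →
        (∀ i j : Fin m, i < j → ∃ c : UCtx α,
          (c.subst (t i) ∈ A.lang ↔ c.subst (t j) ∉ A.lang)) →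
        m - 1 ≤ A.vcard) ∧
    (∀ (α : Type) (A : SDTA α),
      ∀ (m : ℕ) (t : Fin m → UTree α), Function.Injective t →
        (∀ i j : Fin m, i < j → ∃ c : UCtx α,
          (c.subst (t i) ∈ A.lang ↔ c.subst (t j) ∉ A.lang)) →
        m - 1 ≤ A.vcard) := by
  exact ⟨fun _ A hA _ t _ hsep => IsDet.sub_one_le_card hA A.F t hsep,
    fun _ A _ t _ hsep => IsDet.sub_one_le_card A.isDet_hLang A.F t hsep⟩
end

section
/- For every SDTA A = (Q, Σ, δ, F) there exists a DTA(DFA) A' with L(A') = L(A) such that A' has at most |Q| vertical states and at most |Q| · Σ_{σ∈Σ} |S_σ| horizontal states, where S_σ is the state set of the horizontal DFA H_σ of A. -/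
/-- The NTA(DFA) obtained from an SDTA by using, for every vertical state `q` and symbol `a`,
a copy of the horizontal DFA for `a` whose accepting states are those with output `q`. -/
def SDTA.toNTAD {α : Type} (A : SDTA α) : NTAD α where
  Q := A.Q
  S _ a := A.S a
  H q a := ⟨A.step a, A.start a, {s | s ∈ A.hacc a ∧ A.out a s = q}⟩
  F := A.F

theorem SDTA.toNTAD_hcard {α : Type} [Fintype α] (A : SDTA α) :
    A.toNTAD.hcard = A.vcard * A.hcard := by
  change ∑ _q : A.Q, ∑ a : α, Fintype.card (A.S a) = _
  simp [SDTA.vcard, SDTA.hcard]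

/-- every SDTA `A` has an equivalent DTA(DFA) `A'` with at most
`|Q|` vertical states and at most `|Q| · Σ_{σ∈Σ} |S_σ|` horizontal states. -/
theorem statement2 (α : Type) [Fintype α] (A : SDTA α) :
    ∃ B : NTAD α, B.IsDTA ∧ B.lang = A.lang ∧
      B.vcard ≤ A.vcard ∧ B.hcard ≤ A.vcard * A.hcard := by
  exact ⟨A.toNTAD, A.isDet_hLang, rfl, le_rfl, A.toNTAD_hcard.le⟩
end

section
/- (i) Every SDTA with n vertical states and m horizontal states has an equivalent DTA(DFA) with at most n vertical states and at most n·m horizontal states. (ii) For every n ≥ 1 there exists a tree language L_n over Σ = {a, b, 0, 1} recognized by an SDTA with n vertical states and at most 5n horizontal states, such that every DTA(DFA) recognizing L_n has at least n vertical states and at least n² horizontal states. -/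
theorem TReach.node_iff {α Q : Type} {δ : Q → α → Set (List Q)} {a : α}
    {ts : List (UTree α)} {q : Q} :
    TReach δ (.node a ts) q ↔ ∃ qs, List.Forall₂ (TReach δ) ts qs ∧ qs ∈ δ q a := by
  constructor
  · rintro ⟨hlen, hchild, hq⟩
    exact ⟨_, List.forall₂_iff_get.2 ⟨hlen, fun i h _ => hchild ⟨i, h⟩⟩, hq⟩
  · rintro ⟨qs, hqs, hq⟩
    obtain ⟨hlen, hget⟩ := List.forall₂_iff_get.1 hqs
    exact .node hlen (fun i => hget i i.2 (hlen ▸ i.2)) hq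

theorem forall₂_replicate_left_iff {β γ : Type} {R : β → γ → Prop} {t : β} {c : γ}
    (h : ∀ x, R t x ↔ x = c) (k : ℕ) (l : List γ) :
    List.Forall₂ R (List.replicate k t) l ↔ l = List.replicate k c := by
  induction k generalizing l with
  | zero => simp
  | succ k ih => simp [List.replicate_succ, List.forall₂_cons_left_iff, h, ih]

section LeafConvention

variable {α Q : Type} {δ : Q → α → Set (List (Q ⊕ α))}

theorem TReach.leaf_iff (hδ : ∀ q a, [] ∉ δ q a) (a : α) (x : Q ⊕ α) :
    TReach (leafδ δ) (.node a []) x ↔ x = .inr a := by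
  rw [TReach.node_iff]
  rcases x with q | b <;> simp [leafδ, hδ]

/-- The tree with root `a` whose children are `k` leaves labelled `b`. -/
def bush {α : Type} (a b : α) (k : ℕ) : UTree α := .node a (List.replicate k (.node b []))

/-- The tree with root `a` whose children are `bush a b k` followed by `j` leaves labelled `b`. -/
def twoLevel {α : Type} (a b : α) (k j : ℕ) : UTree α :=
  .node a (bush a b k :: List.replicate j (.node b []))

theorem TReach.bush_iff (hδ : ∀ q a, [] ∉ δ q a) (a b : α) {k : ℕ} (hk : k ≠ 0) (x : Q ⊕ α) :
    TReach (leafδ δ) (bush a b k) x ↔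
      ∃ p, x = .inl p ∧ List.replicate k (.inr b) ∈ δ p a := by
  rw [bush, TReach.node_iff]
  simp only [forall₂_replicate_left_iff (TReach.leaf_iff hδ b), exists_eq_left]
  rcases x with q | c <;> simp [leafδ, hk]

theorem TReach.twoLevel_iff (hδ : ∀ q a, [] ∉ δ q a) (a b : α) {k : ℕ} (hk : k ≠ 0) (j : ℕ)
    (x : Q ⊕ α) :
    TReach (leafδ δ) (twoLevel a b k j) x ↔
      ∃ p, List.replicate k (.inr b) ∈ δ p a ∧
        .inl p :: List.replicate j (.inr b) ∈ leafδ δ x a := by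
  rw [twoLevel, TReach.node_iff]
  simp only [List.forall₂_cons_left_iff, forall₂_replicate_left_iff (TReach.leaf_iff hδ b),
    TReach.bush_iff hδ a b hk]
  aesop

end LeafConvention

/-- The DTA(DFA) obtained from an SDTA by using a copy of its horizontal automaton for every
vertical state. -/
def CSDTA.toCNTAD {α : Type} (A : CSDTA α) : CNTAD α where
  Q := A.Q
  S _ a := A.S a
  H q a := ⟨A.step a, A.start a, {s | s ∈ A.hacc a ∧ A.out a s = q}⟩
  F := A.F
  noeps _ a h := A.noeps a h.1

theorem CSDTA.toCNTAD_isDTA {α : Type} (A : CSDTA α) : A.toCNTAD.IsDTA := by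
  intro a q₁ q₂ hne
  refine Set.eq_empty_of_forall_notMem ?_
  rintro w ⟨⟨-, h₁⟩, -, h₂⟩
  exact hne (h₁.symm.trans h₂)

theorem CSDTA.toCNTAD_hcard {α : Type} [Fintype α] (A : CSDTA α) :
    A.toCNTAD.hcard = A.vcard * A.hcard := by
  change ∑ _q : A.Q, ∑ a : α, Fintype.card (A.S a) = _
  simp [CSDTA.vcard, CSDTA.hcard]

section LeafCount

variable (n : ℕ)

/-- The horizontal step for the symbol `a`: for `a = 0`, add up the values of the children modulo
`n`, where leaves have value `1`. -/
def leafCountStep (a : Fin 4) (s : Option {_z : ZMod n // a = 0}) (x : ZMod n ⊕ Fin 4) :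
    Option {_z : ZMod n // a = 0} :=
  if h : a = 0 then some ⟨s.elim 0 (·.1) + x.elim id 1, h⟩ else none

theorem foldl_leafCountStep (w : List (ZMod n ⊕ Fin 4))
    (s : Option {_z : ZMod n // (0 : Fin 4) = 0}) :
    (w.foldl (leafCountStep n 0) s).elim 0 (·.1) =
      s.elim 0 (·.1) + (w.map (Sum.elim id 1)).sum := by
  induction w generalizing s with
  | nil => simp
  | cons x w ih =>
    rw [List.foldl_cons, ih]
    simp [leafCountStep, add_assoc]

theorem isSome_foldl_leafCountStep (w : List (ZMod n ⊕ Fin 4))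
    (s : Option {_z : ZMod n // (0 : Fin 4) = 0}) :
    (w.foldl (leafCountStep n 0) s).isSome ↔ s.isSome ∨ w ≠ [] := by
  induction w generalizing s with
  | nil => simp
  | cons x w ih =>
    rw [List.foldl_cons, ih]
    simp [leafCountStep]

variable [NeZero n]

/-- The SDTA computing the number of leaves modulo `n` of trees all of whose inner nodes are
labelled `0`; it accepts if the result is `0` and the tree is not a leaf. -/
def leafCount : CSDTA (Fin 4) where
  Q := ZMod n
  S a := Option {_z : ZMod n // a = 0}
  start _ := none
  step := leafCountStep n
  hacc _ := {s | s.isSome}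
  out _ s := s.elim 0 (·.1)
  F := {.inl 0}
  noeps := by simp

theorem mem_leafCount_hLang (w : List (ZMod n ⊕ Fin 4)) (q : ZMod n) :
    w ∈ (leafCount n).hLang q 0 ↔ w ≠ [] ∧ (w.map (Sum.elim id 1)).sum = q := by
  have h₁ := foldl_leafCountStep n w none
  have h₂ := isSome_foldl_leafCountStep n w none
  simp only [Option.elim_none, zero_add, Option.isSome_none, Bool.false_eq_true, false_or] at h₁ h₂
  rw [← h₂, ← h₁]
  rfl

theorem replicate_mem_leafCount_hLang {k : ℕ} (hk : k ≠ 0) (p : ZMod n) :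
    List.replicate k (.inr 2) ∈ (leafCount n).hLang p 0 ↔ (k : ZMod n) = p := by
  refine (mem_leafCount_hLang n (List.replicate k (.inr 2)) p).trans ?_
  simp [hk]

theorem cons_replicate_mem_leafCount_hLang (p q : ZMod n) (j : ℕ) :
    .inl p :: List.replicate j (.inr 2) ∈ (leafCount n).hLang q 0 ↔ p + j = q := by
  refine (mem_leafCount_hLang n (.inl p :: List.replicate j (.inr 2)) q).trans ?_
  simp

theorem leafCount_vcard : (leafCount n).vcard = n := ZMod.card n

theorem leafCount_hcard : (leafCount n).hcard = n + 4 := by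
  have h (a : Fin 4) : Fintype.card ((leafCount n).S a) = (if a = 0 then n else 0) + 1 := by
    change Fintype.card (Option {_z : ZMod n // a = 0}) = _
    rw [Fintype.card_option, Fintype.card_subtype]
    split_ifs with h <;> simp [h, ZMod.card]
  simp [CSDTA.hcard, h, Finset.sum_add_distrib]

theorem twoLevel_mem_leafCount_lang {k : ℕ} (hk : k ≠ 0) (j : ℕ) :
    twoLevel 0 2 k j ∈ (leafCount n).lang ↔ (k : ZMod n) + j = 0 := by
  have hδ : ∀ q a, [] ∉ (leafCount n).hLang q a := fun q a h => (leafCount n).noeps a h.1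
  constructor
  · rintro ⟨x, rfl, hx⟩
    obtain ⟨p, h₁, h₂⟩ := (TReach.twoLevel_iff hδ 0 2 hk j _).1 hx
    rw [(replicate_mem_leafCount_hLang n hk p).1 h₁]
    exact (cons_replicate_mem_leafCount_hLang n p 0 j).1 h₂
  · intro h
    exact ⟨.inl (0 : ZMod n), rfl, (TReach.twoLevel_iff hδ 0 2 hk j _).2
      ⟨(k : ZMod n), (replicate_mem_leafCount_hLang n hk _).2 rfl,
        (cons_replicate_mem_leafCount_hLang n _ _ j).2 h⟩⟩

variable {n} {B : CNTAD (Fin 4)}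

theorem exists_replicate_mem_hLang (hL : B.lang = (leafCount n).lang) {k : ℕ} (hk : k ≠ 0) :
    ∃ p, List.replicate k (.inr 2) ∈ B.hLang p 0 := by
  have h : twoLevel 0 2 k (-(k : ZMod n)).val ∈ B.lang := by
    rw [hL, twoLevel_mem_leafCount_lang n hk]
    simp
  obtain ⟨x, -, hx⟩ := h
  obtain ⟨p, hp, -⟩ := (TReach.twoLevel_iff B.noeps 0 2 hk _ x).1 hx
  exact ⟨p, hp⟩

theorem natCast_eq_of_replicate_mem_hLang (hB : B.IsDTA) (hL : B.lang = (leafCount n).lang)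
    {k l : ℕ} (hk : k ≠ 0) (hl : l ≠ 0) {p : B.Q}
    (hpk : List.replicate k (.inr 2) ∈ B.hLang p 0)
    (hpl : List.replicate l (.inr 2) ∈ B.hLang p 0) : (k : ZMod n) = l := by
  have h : twoLevel 0 2 k (-(k : ZMod n)).val ∈ B.lang := by
    rw [hL, twoLevel_mem_leafCount_lang n hk]
    simp
  have h' : twoLevel 0 2 l (-(k : ZMod n)).val ∈ B.lang := by
    obtain ⟨x, hxF, hx⟩ := h
    obtain ⟨p', hp', hx⟩ := (TReach.twoLevel_iff B.noeps 0 2 hk _ x).1 hx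
    obtain rfl : p' = p := by
      by_contra hne
      exact (hB 0 p' p hne).subset ⟨hp', hpk⟩
    exact ⟨x, hxF, (TReach.twoLevel_iff B.noeps 0 2 hl _ x).2 ⟨p', hpl, hx⟩⟩
  rw [hL, twoLevel_mem_leafCount_lang n hl] at h'
  simp only [ZMod.natCast_val, ZMod.cast_id', id_eq] at h'
  linear_combination -h'

theorem le_card_of_replicate_mem_hLang (hB : B.IsDTA) (hL : B.lang = (leafCount n).lang)
    {k : ℕ} (hk : n ≤ k) {p : B.Q} (hpk : List.replicate k (.inr 2) ∈ B.hLang p 0) :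
    n ≤ Fintype.card (B.S p 0) := by
  by_contra! hlt
  obtain ⟨x, y, z, hxyz, hlen, hy, hsub⟩ :=
    (B.H p 0).pumping_lemma hpk (by simpa using (hlt.trans_le hk).le)
  have hpump : x ++ (y ++ y) ++ z ∈ B.hLang p 0 :=
    hsub (Language.append_mem_mul (Language.append_mem_mul (Set.mem_singleton x)
      (Language.mem_kstar.2 ⟨[y, y], by simp, fun v hv => show v = y by simpa using hv⟩))
        (Set.mem_singleton z))
  have hrep : x ++ (y ++ y) ++ z = List.replicate (k + y.length) (.inr 2) := by
    obtain ⟨hk', hall⟩ := List.eq_replicate_iff.1 hxyz.symm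
    refine List.eq_replicate_iff.2 ⟨?_, fun c hc => hall c ?_⟩
    · simp only [List.length_append] at hk' ⊢
      omega
    · simp only [List.mem_append] at hc ⊢
      tauto
  rw [hrep] at hpump
  have hn : n ≠ 0 := NeZero.ne n
  have heq := natCast_eq_of_replicate_mem_hLang hB hL (by omega) (by omega) hpk hpump
  rw [Nat.cast_add, left_eq_add, ZMod.natCast_eq_zero_iff] at heq
  have := Nat.le_of_dvd (List.length_pos_iff.2 hy) heq
  omega

theorem le_card_of_lang_eq_leafCount (hB : B.IsDTA) (hL : B.lang = (leafCount n).lang) :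
    n ≤ B.vcard ∧ n ^ 2 ≤ B.hcard := by
  have hne (i : ZMod n) : n + i.val ≠ 0 := by simp [NeZero.ne n]
  choose p hp using fun i : ZMod n => exists_replicate_mem_hLang hL (hne i)
  have hinj : Function.Injective p := fun i j hij => by
    simpa using natCast_eq_of_replicate_mem_hLang hB hL (hne i) (hne j) (hp i) (hij ▸ hp j)
  refine ⟨by simpa [ZMod.card, CNTAD.vcard] using Fintype.card_le_of_injective p hinj, ?_⟩
  calc n ^ 2 = ∑ _i : ZMod n, n := by simp [ZMod.card, sq]
    _ ≤ ∑ i, Fintype.card (B.S (p i) 0) := Finset.sum_le_sum fun i _ =>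
        le_card_of_replicate_mem_hLang hB hL (Nat.le_add_right _ _) (hp i)
    _ = ∑ q ∈ Finset.univ.map ⟨p, hinj⟩, Fintype.card (B.S q 0) := by
        rw [Finset.sum_map]; rfl
    _ ≤ ∑ q, Fintype.card (B.S q 0) := Finset.sum_le_sum_of_subset (Finset.subset_univ _)
    _ ≤ B.hcard := Finset.sum_le_sum fun q _ =>
        Finset.single_le_sum (f := fun a => Fintype.card (B.S q a))
          (fun _ _ => Nat.zero_le _) (Finset.mem_univ 0)

end LeafCount

/-- (i) every SDTA with `n` vertical and `m` horizontal states has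
an equivalent DTA(DFA) with at most `n` vertical and at most `n·m` horizontal
states; (ii) for every `n ≥ 1` there is a tree language over a four-letter
alphabet recognized by an SDTA with `n` vertical and at most `5n` horizontal
states such that every DTA(DFA) recognizing it has at least `n` vertical and at
least `n²` horizontal states. -/
theorem statement4 :
    (∀ (α : Type) [Fintype α] (A : CSDTA α),
      ∃ B : CNTAD α, B.IsDTA ∧ B.lang = A.lang ∧
        B.vcard ≤ A.vcard ∧ B.hcard ≤ A.vcard * A.hcard) ∧
    (∀ n : ℕ, 1 ≤ n →
      ∃ A : CSDTA (Fin 4), A.vcard = n ∧ A.hcard ≤ 5 * n ∧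
        ∀ B : CNTAD (Fin 4), B.IsDTA → B.lang = A.lang →
          n ≤ B.vcard ∧ n ^ 2 ≤ B.hcard) := by
  refine ⟨fun α _ A => ⟨A.toCNTAD, A.toCNTAD_isDTA, rfl, le_rfl, A.toCNTAD_hcard.le⟩,
    fun n hn => ?_⟩
  have : NeZero n := ⟨by omega⟩
  refine ⟨leafCount n, leafCount_vcard n, ?_, fun B hB hL => le_card_of_lang_eq_leafCount hB hL⟩
  rw [leafCount_hcard]
  omega
end

section
/- Let m ≥ 1 and let 2 ≤ k_1 < k_2 < … < k_m be pairwise relatively prime integers, and for 1 ≤ i ≤ m let y_i ∈ {0,1}* denote the binary representation of i. Consider the string language L = ⋃_{i=1}^m { b^{c·k_i} · y_i : c ≥ 0 } over the three-letter alphabet {b, 0, 1}. Then every DFA recognizing L has at least ∏_{i=1}^m k_i states. -/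
/-- The binary representation of `i` as a word over the symbols `1` ("0") and
`2` ("1") of the three-letter alphabet `{b,0,1} = Fin 3` (with `b = 0`). -/
def binRep3 (i : ℕ) : List (Fin 3) :=
  ((Nat.digits 2 i).reverse).map fun d => if d = 1 then (2 : Fin 3) else 1

/-- The string language `L = ⋃_{i=1}^m { b^{c·k_i} · y_i : c ≥ 0 }` over
`{b,0,1} = Fin 3`. -/
def strL16 (m : ℕ) (k : Fin m → ℕ) : Language (Fin 3) :=
  {w | ∃ (i : Fin m) (c : ℕ),
    w = List.replicate (c * k i) (0 : Fin 3) ++ binRep3 (i.1 + 1)}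

theorem zero_notMem_binRep3 (i : ℕ) : (0 : Fin 3) ∉ binRep3 i := by
  intro h
  obtain ⟨d, -, hd⟩ := List.mem_map.1 h
  split_ifs at hd <;> simp at hd

theorem binRep3_injective : Function.Injective binRep3 := by
  have key (i : ℕ) : (binRep3 i).map (fun x => x.val - 1) = (Nat.digits 2 i).reverse := by
    rw [binRep3, List.map_map]
    conv_rhs => rw [← List.map_id (Nat.digits 2 i).reverse]
    refine List.map_congr_left fun d hd => ?_
    have hlt : d < 2 := Nat.digits_lt_base (by norm_num) (List.mem_reverse.1 hd)
    interval_cases d <;> rfl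
  intro i j hij
  have h := key i
  rw [hij, key j] at h
  exact (Nat.digits_inj_iff.1 (List.reverse_injective h)).symm

/-- A block of copies of `a` followed by a word without `a` splits uniquely. -/
theorem List.replicate_append_inj_of_notMem {α : Type*} [DecidableEq α] {a : α} {p q : ℕ}
    {u v : List α} (hu : a ∉ u) (hv : a ∉ v)
    (h : List.replicate p a ++ u = List.replicate q a ++ v) : p = q ∧ u = v := by
  have hc := congrArg (List.count a) h
  simp only [List.count_append, List.count_replicate_self, List.count_eq_zero_of_not_mem hu,
    List.count_eq_zero_of_not_mem hv, add_zero] at hc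
  subst hc
  exact ⟨rfl, List.append_cancel_left h⟩

theorem replicate_append_binRep3_mem_strL16 {m : ℕ} {k : Fin m → ℕ} {n : ℕ} {i : Fin m} :
    List.replicate n (0 : Fin 3) ++ binRep3 (i.1 + 1) ∈ strL16 m k ↔ k i ∣ n := by
  constructor
  · rintro ⟨j, c, h⟩
    obtain ⟨rfl, hy⟩ := List.replicate_append_inj_of_notMem (zero_notMem_binRep3 _)
      (zero_notMem_binRep3 _) h
    have hij : i = j := Fin.ext (Nat.succ_injective (binRep3_injective hy))
    exact hij ▸ dvd_mul_left _ _
  · rintro ⟨c, rfl⟩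
    exact ⟨i, c, by rw [mul_comm]⟩

/-- Powers of `b` that lead to the same state are congruent modulo every `k i`. -/
theorem modEq_of_eval_replicate_eq {m : ℕ} {k : Fin m → ℕ} {σ : Type*} {A : DFA (Fin 3) σ}
    (hA : A.accepts = strL16 m k) {r s : ℕ}
    (h : A.eval (List.replicate r 0) = A.eval (List.replicate s 0)) {i : Fin m}
    (hi : 0 < k i) : r ≡ s [MOD k i] := by
  obtain ⟨t, ht⟩ := Nat.exists_eq_add_of_le (Nat.le_mul_of_pos_left r hi)
  have iff_dvd (n : ℕ) : A.evalFrom (A.eval (List.replicate n 0))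
      (List.replicate t 0 ++ binRep3 (i.1 + 1)) ∈ A.accept ↔ k i ∣ n + t := by
    rw [DFA.eval, ← DFA.evalFrom_of_append, ← List.append_assoc, List.replicate_append_replicate,
      ← replicate_append_binRep3_mem_strL16, ← hA]
    rfl
  have hr : k i ∣ r + t := ht ▸ dvd_mul_right _ _
  have hs : k i ∣ s + t := (iff_dvd s).1 (h ▸ (iff_dvd r).2 hr)
  exact Nat.ModEq.add_right_cancel' t
    ((Nat.modEq_zero_iff_dvd.2 hr).trans (Nat.modEq_zero_iff_dvd.2 hs).symm)

/-- every DFA recognizing `L` has at least `∏_{i=1}^m k_i`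
states. -/
theorem statement16 (m : ℕ) (hm : 1 ≤ m) (k : Fin m → ℕ)
    (hk2 : ∀ i, 2 ≤ k i) (hmono : StrictMono k)
    (hcop : ∀ i j, i ≠ j → Nat.Coprime (k i) (k j))
    (σ : Type) [Fintype σ] (A : DFA (Fin 3) σ)
    (hA : A.accepts = strL16 m k) :
    ∏ i, k i ≤ Fintype.card σ := by
  have hinj : Function.Injective
      fun n : Fin (∏ i, k i) => A.eval (List.replicate n.1 (0 : Fin 3)) := by
    intro r s h
    have hdvd : (∏ i, (k i : ℤ)) ∣ (s.1 : ℤ) - r.1 :=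
      Fintype.prod_dvd_of_coprime
        (fun i j hij => Nat.isCoprime_iff_coprime.2 (hcop i j hij))
        (fun i => (modEq_of_eval_replicate_eq hA h (by have := hk2 i; omega)).dvd)
    refine Fin.ext (Nat.ModEq.eq_of_lt_of_lt (Nat.modEq_iff_dvd.2 ?_) r.2 s.2)
    exact_mod_cast hdvd
  simpa using Fintype.card_le_of_injective _ hinj
end
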